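/- arXiv:1909.02792 — 5 statements merged into one kernel-verified Lean document; each statement's English description precedes it below -/
import Mathlib

section
/- The distributed dual problem: minimize over μ ∈ ℝⁿ the function (1/2) μᵀK⁻¹μ − (P*)ᵀμ subject to the consensus constraint E_cᵀμ = 0, has the unique minimizer μ = μ_opt·1ₙ, where μ_opt = 1ₙᵀP* / (1ₙᵀK⁻¹1ₙ). In particular, the consensus constraint forces all local multipliers μᵢ to agree at optimality. -/
/-- The distributed dual problem: minimize (1/2)μᵀK⁻¹μ − (P*)ᵀμ over μ ∈ ℝⁿ
subject to the consensus constraint E_cᵀμ = 0 (E_c the incidence matrix of a connected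
communication graph) has the unique minimizer μ = μ_opt·1ₙ, μ_opt = 1ₙᵀP*/(1ₙᵀK⁻¹1ₙ). -/
theorem distributed_dual_unique_minimizer
    {n nE : ℕ} (hn : 1 ≤ n)
    (k : Fin n → ℝ) (hk : ∀ i, 0 < k i)
    (Pstar : Fin n → ℝ)
    (Ec : Matrix (Fin n) (Fin nE) ℝ)
    (hinc : ∀ e : Fin nE, ∃ i j : Fin n, i ≠ j ∧ Ec i e = 1 ∧ Ec j e = -1 ∧
      ∀ l : Fin n, l ≠ i → l ≠ j → Ec l e = 0)
    (hconn : ∀ μ : Fin n → ℝ, Ec.transpose.mulVec μ = 0 ↔ ∃ c : ℝ, μ = fun _ => c)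
    (f : (Fin n → ℝ) → ℝ)
    (hf : f = fun μ => (1 / 2 : ℝ) * (∑ i, (k i)⁻¹ * (μ i) ^ 2) - ∑ i, Pstar i * μ i)
    (μopt : ℝ) (hμopt : μopt = (∑ i, Pstar i) / (∑ i, (k i)⁻¹)) :
    Ec.transpose.mulVec (fun _ => μopt) = 0 ∧
    ∀ μ : Fin n → ℝ, Ec.transpose.mulVec μ = 0 → μ ≠ (fun _ => μopt) →
      f (fun _ => μopt) < f μ := by
  have hS : 0 < ∑ i, (k i)⁻¹ :=
    Finset.sum_pos (fun i _ => inv_pos.2 (hk i)) ⟨⟨0, hn⟩, Finset.mem_univ _⟩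
  have hP : ∑ i, Pstar i = μopt * ∑ i, (k i)⁻¹ := by
    rw [hμopt, div_mul_cancel₀ _ hS.ne']
  refine ⟨(hconn _).2 ⟨μopt, rfl⟩, fun μ hμ hne => ?_⟩
  obtain ⟨c, rfl⟩ := (hconn μ).1 hμ
  have hc : c - μopt ≠ 0 := fun h => hne (by rw [sub_eq_zero.1 h])
  simp only [hf, ← Finset.sum_mul, hP]
  linarith [mul_pos hS (sq_pos_iff.2 hc)]
end

section
/- Consider the closed loop of the swing dynamics with the centralized broadcast averaging controller: θ̇ = ω, M ω̇ = −Lθ − Dω + P* − μK⁻¹1ₙ, τ_μ μ̇ = ∑ⱼ rⱼωⱼ, where rⱼ > 0 with ∑ⱼ rⱼ = 1. Then (i) there exists θ* ∈ ℝⁿ with Lθ* = P* − μ_opt K⁻¹1ₙ, where μ_opt = 1ₙᵀP*/(1ₙᵀK⁻¹1ₙ), and every point (θ* + c·1ₙ, 0, μ_opt), c ∈ ℝ, is an equilibrium of the closed loop; (ii) conversely, every equilibrium (θ, ω, μ) of the closed loop satisfies ω = 0, μ = μ_opt, and θ = θ* + c·1ₙ for some c ∈ ℝ; at any such equilibrium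 the control input p = −μK⁻¹1ₙ equals the minimizer p_opt of the problem of minimizing (1/2)pᵀKp subject to 0 = 1ₙᵀ(P*+p). -/
/-- The entries of `L *ᵥ x` sum to zero when `L` is symmetric and annihilates constants. -/
lemma Matrix.IsSymm.sum_mulVec_eq_zero {ι : Type*} [Fintype ι] {L : Matrix ι ι ℝ}
    (hL : L.IsSymm) (hone : L.mulVec 1 = 0) (x : ι → ℝ) : ∑ i, L.mulVec x i = 0 := by
  rw [← one_dotProduct, dotProduct_mulVec, ← mulVec_transpose, hL.eq, hone, zero_dotProduct]

/-- A symmetric matrix whose kernel is the constants has every zero-sum vector in its range. -/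
lemma Matrix.IsSymm.exists_mulVec_eq_of_sum_eq_zero {ι : Type*} [Fintype ι] [Nonempty ι]
    {L : Matrix ι ι ℝ} (hL : L.IsSymm)
    (hker : ∀ x : ι → ℝ, L.mulVec x = 0 ↔ ∃ c : ℝ, x = fun _ => c)
    {b : ι → ℝ} (hb : ∑ i, b i = 0) : ∃ x, L.mulVec x = b := by
  have hone : L.mulVec 1 = 0 := (hker 1).2 ⟨1, rfl⟩
  let J : Matrix ι ι ℝ := Matrix.of fun _ _ => 1
  have hJ (x : ι → ℝ) (i : ι) : J.mulVec x i = ∑ j, x j := by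
    simp [J, mulVec, dotProduct]
  have hsum (x : ι → ℝ) (h : ∑ i, (L + J).mulVec x i = 0) : ∑ j, x j = 0 := by
    simpa [add_mulVec, Finset.sum_add_distrib, hL.sum_mulVec_eq_zero hone, hJ] using h
  have hJ0 {x : ι → ℝ} (h : ∑ j, x j = 0) : (L + J).mulVec x = L.mulVec x := by
    ext i
    simp [add_mulVec, hJ, h]
  have hinj : Function.Injective (L + J).mulVecLin := by
    rw [injective_iff_map_eq_zero]
    intro x hx
    rw [mulVecLin_apply] at hx
    have hx0 := hsum x (by simp [hx])
    obtain ⟨c, rfl⟩ := (hker x).1 ((hJ0 hx0).symm.trans hx)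
    have hc : c = 0 := by simpa using hx0
    simp only [hc]
    rfl
  obtain ⟨x, hx⟩ := LinearMap.injective_iff_surjective.1 hinj b
  rw [mulVecLin_apply] at hx
  exact ⟨x, (hJ0 (hsum x (hx ▸ hb))).symm.trans hx⟩

/-- Equilibria of the swing dynamics in closed loop with the centralized
broadcast averaging controller: θ̇ = ω, Mω̇ = −Lθ − Dω + P* − μK⁻¹1ₙ, τ_μμ̇ = ∑ⱼrⱼωⱼ.
(i) There is θ* with Lθ* = P* − μ_opt K⁻¹1ₙ and every (θ*+c·1ₙ, 0, μ_opt) is an equilibrium;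
(ii) every equilibrium (θ,ω,μ) has ω = 0, μ = μ_opt = 1ₙᵀP*/(1ₙᵀK⁻¹1ₙ), θ = θ*+c·1ₙ, and the
control input p = −μK⁻¹1ₙ equals the OFRP minimizer p_opt. -/
theorem broadcast_closed_loop_equilibria
    {n : ℕ} (hn : 1 ≤ n)
    (L : Matrix (Fin n) (Fin n) ℝ)
    (hL : L.PosSemidef)
    (hker : ∀ x : Fin n → ℝ, L.mulVec x = 0 ↔ ∃ c : ℝ, x = fun _ => c)
    (m d k : Fin n → ℝ) (hm : ∀ i, 0 < m i) (hd : ∀ i, 0 < d i) (hk : ∀ i, 0 < k i)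
    (Pstar : Fin n → ℝ) (τμ : ℝ) (hτμ : 0 < τμ)
    (r : Fin n → ℝ) (hr : ∀ j, 0 < r j) (hr1 : (∑ j, r j) = 1)
    (isEquil : (Fin n → ℝ) → (Fin n → ℝ) → ℝ → Prop)
    (hisEquil : isEquil = fun θ ω μ =>
      ω = 0 ∧
      -(L.mulVec θ) - (fun i => d i * ω i) + Pstar - μ • (fun i => (k i)⁻¹) = 0 ∧
      (∑ j, r j * ω j) = 0)
    (μopt : ℝ) (hμopt : μopt = (∑ i, Pstar i) / (∑ i, (k i)⁻¹))
    (popt : Fin n → ℝ) (hpopt : popt = fun i => -((∑ j, Pstar j) / (∑ j, (k j)⁻¹)) * (k i)⁻¹) :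
    ∃ θstar : Fin n → ℝ,
      L.mulVec θstar = Pstar - μopt • (fun i => (k i)⁻¹) ∧
      (∀ c : ℝ, isEquil (θstar + fun _ => c) 0 μopt) ∧
      (∀ θ ω μ, isEquil θ ω μ →
        ω = 0 ∧ μ = μopt ∧ (∃ c : ℝ, θ = θstar + fun _ => c) ∧
        (-μ) • (fun i => (k i)⁻¹) = popt) := by
  have : Nonempty (Fin n) := ⟨⟨0, hn⟩⟩
  have hsymm : L.IsSymm := by simpa using hL.isHermitian
  have hone : L.mulVec 1 = 0 := (hker 1).2 ⟨1, rfl⟩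
  have hS : 0 < ∑ i, (k i)⁻¹ :=
    Finset.sum_pos (fun i _ => inv_pos.2 (hk i)) Finset.univ_nonempty
  have hbal (ν : ℝ) : ∑ i, (Pstar - ν • (fun i => (k i)⁻¹)) i =
      ∑ i, Pstar i - ν * ∑ i, (k i)⁻¹ := by
    simp [Finset.sum_sub_distrib, Finset.mul_sum]
  obtain ⟨θstar, hθstar⟩ := hsymm.exists_mulVec_eq_of_sum_eq_zero hker
    (b := Pstar - μopt • (fun i => (k i)⁻¹))
    (by rw [hbal, hμopt, div_mul_cancel₀ _ hS.ne', sub_self])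
  subst hisEquil
  refine ⟨θstar, hθstar, fun c => ⟨rfl, ?_, by simp⟩, ?_⟩
  · rw [Matrix.mulVec_add, (hker fun _ => c).2 ⟨c, rfl⟩, hθstar]
    ext i
    simp
  · rintro θ ω μ ⟨rfl, hθ, -⟩
    have hLθ : L.mulVec θ = Pstar - μ • (fun i => (k i)⁻¹) := by
      ext i
      have := congrFun hθ i
      simp at this ⊢
      linarith
    have hμ : μ = μopt := by
      have := hsymm.sum_mulVec_eq_zero hone θ
      rw [hLθ, hbal] at this
      rw [hμopt, eq_div_iff hS.ne']
      linarith
    subst hμ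
    obtain ⟨c, hc⟩ := (hker (θ - θstar)).1 (by rw [Matrix.mulVec_sub, hLθ, hθstar, sub_self])
    refine ⟨rfl, rfl, ⟨c, by rw [← hc, add_sub_cancel]⟩, ?_⟩
    rw [hpopt, hμopt]
    rfl
end

section
/- (Per-mode stability for the distributed averaging controller.) For any λ > 0 and m, d, k, τ, γ > 0, the 3×3 matrix A_λ = [[0, 1, 0], [−λ/m, −d/m, 1/m], [0, −1/(τk), −γλ/τ]] is Hurwitz: all of its eigenvalues have strictly negative real part. -/
/-- The **Routh–Hurwitz criterion** for monic real cubics: if `0 < a`, `0 < b`, `0 < c` and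
`c < a * b`, every complex root of `z ^ 3 + a * z ^ 2 + b * z + c` has negative real part. -/
theorem Complex.re_neg_of_cubic_eq_zero {a b c : ℝ} (ha : 0 < a) (hb : 0 < b) (hc : 0 < c)
    (habc : c < a * b) {z : ℂ} (hz : z ^ 3 + a * z ^ 2 + b * z + c = 0) : z.re < 0 := by
  obtain ⟨x, y⟩ := z
  have hre : x ^ 3 - 3 * x * y ^ 2 + a * (x ^ 2 - y ^ 2) + b * x + c = 0 := by
    have h := congrArg Complex.re hz
    simp [pow_succ] at h
    linear_combination h
  have him : y * (3 * x ^ 2 - y ^ 2 + 2 * a * x + b) = 0 := by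
    have h := congrArg Complex.im hz
    simp [pow_succ] at h
    linear_combination h
  change x < 0
  by_contra! hx
  rcases mul_eq_zero.mp him with hy | hy
  · subst hy
    have : 0 < x ^ 3 + a * x ^ 2 + b * x + c := by positivity
    linarith
  · have h : 8 * x ^ 3 + 8 * a * x ^ 2 + 2 * a ^ 2 * x + 2 * b * x + (a * b - c) = 0 := by
      linear_combination (3 * x + a) * hy - hre
    have : 0 ≤ 8 * x ^ 3 + 8 * a * x ^ 2 + 2 * a ^ 2 * x + 2 * b * x := by positivity
    linarith

/-- Per-mode stability for the distributed averaging controller: for λ > 0 and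
m, d, k, τ, γ > 0, the matrix A_λ = [[0, 1, 0], [−λ/m, −d/m, 1/m], [0, −1/(τk), −γλ/τ]] is
Hurwitz: all of its complex eigenvalues have strictly negative real part. -/
theorem per_mode_matrix_isHurwitz
    (m d k τ γ lam : ℝ)
    (hm : 0 < m) (hd : 0 < d) (hk : 0 < k) (hτ : 0 < τ) (hγ : 0 < γ) (hlam : 0 < lam) :
    ∀ μ ∈ spectrum ℂ
      ((!![0, 1, 0; -lam / m, -d / m, 1 / m; 0, -1 / (τ * k), -γ * lam / τ]
          : Matrix (Fin 3) (Fin 3) ℝ).map (Complex.ofReal : ℝ → ℂ)),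
      μ.re < 0 := by
  intro μ hμ
  rw [spectrum.mem_iff, Matrix.isUnit_iff_isUnit_det, isUnit_iff_ne_zero, not_not,
    Matrix.det_fin_three] at hμ
  simp [Matrix.algebraMap_matrix_apply] at hμ
  have hgap : 0 < (d / m + γ * lam / τ) * (lam / m + d * γ * lam / (m * τ) + 1 / (m * τ * k))
      - γ * lam ^ 2 / (m * τ) := by
    have h : 0 < d / m * (lam / m) + (d / m + γ * lam / τ) *
        (d * γ * lam / (m * τ) + 1 / (m * τ * k)) := by positivity
    convert h using 1
    field_simp
    ring
  refine Complex.re_neg_of_cubic_eq_zero (a := d / m + γ * lam / τ)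
    (b := lam / m + d * γ * lam / (m * τ) + 1 / (m * τ * k)) (c := γ * lam ^ 2 / (m * τ))
    (by positivity) (by positivity) (by positivity) (sub_pos.mp hgap) ?_
  push_cast
  rw [← hμ]
  ring
end

section
/- (Per-mode H₂ contribution for the distributed averaging controller.) Let λ > 0 and m, d, k, τ, γ, b > 0, and consider the 3×3 Hurwitz matrix A_λ = [[0, 1, 0], [−λ/m, −d/m, 1/m], [0, −1/(τk), −γλ/τ]], the output row vector C_λ = (0, 0, √k), and the input column vector B_λ = (0, b/m, 0)ᵀ. Then the unique symmetric solution X_λ of the Lyapunov equation X A_λ + A_λᵀ X + C_λᵀ C_λ = 0 satisfies B_λᵀ X_λ B_λ = (b²/(2τd)) · 1/(z₂λ² + z₁λ + 1), where z₂ = mkγ²/τ and z₁ = mγ/(dτ) + kdγ + kτ. -/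
/-- The linear system in the entries of a symmetric observability Gramian
`!![p, q, r; q, s, t; r, t, u]` of a mode, written out entrywise, is equivalent to its
explicit solution. -/
theorem gramian_entries_iff {m d k τ γ lam P : ℝ}
    (hm : 0 < m) (hd : 0 < d) (hk : 0 < k) (hτ : 0 < τ) (hγ : 0 < γ) (hlam : 0 < lam)
    (hP : P = (m * k * γ ^ 2 / τ) * lam ^ 2 + (m * γ / (d * τ) + k * d * γ + k * τ) * lam + 1)
    (p q r s t u : ℝ) :
    (q * (-lam / m) = 0 ∧
      p + q * (-d / m) + r * (-1 / (τ * k)) + s * (-lam / m) = 0 ∧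
      q + s * (-d / m) + t * (-1 / (τ * k)) = 0 ∧
      q * (1 / m) + r * (-γ * lam / τ) + t * (-lam / m) = 0 ∧
      s * (1 / m) + t * (-γ * lam / τ) + r + t * (-d / m) + u * (-1 / (τ * k)) = 0 ∧
      2 * (t * (1 / m) + u * (-γ * lam / τ)) + k = 0) ↔
    (p = 1 / (2 * γ * P) + lam * m / (2 * d * τ * P) ∧ q = 0 ∧ r = k * τ / (2 * γ * P) ∧
      s = m ^ 2 / (2 * d * τ * P) ∧ t = -(k * m) / (2 * P) ∧
      u = k * τ * (1 - 1 / P) / (2 * γ * lam)) := by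
  have hP0 : 0 < P := by rw [hP]; positivity
  have hP' : P * (d * τ) = m * k * γ ^ 2 * d * lam ^ 2
      + (m * γ + k * d ^ 2 * γ * τ + k * τ ^ 2 * d) * lam + d * τ := by
    rw [hP]; field_simp
  constructor
  · rintro ⟨h₁, h₂, h₃, h₄, h₅, h₆⟩
    have hq : q = 0 := by
      have : -lam / m ≠ 0 := by
        have := hlam.ne'
        have := hm.ne'
        simp [*]
      exact (mul_eq_zero.mp h₁).resolve_right this
    subst hq
    have hs : s = -(t * m) / (d * τ * k) := by
      field_simp at h₃ ⊢
      linarith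
    have hr : r = -(t * τ) / (m * γ) := by
      field_simp at h₄ ⊢
      exact mul_right_cancel₀ hlam.ne' (by linarith)
    have hu : u = (t / m + k / 2) * τ / (γ * lam) := by
      field_simp at h₆ ⊢
      linarith
    have hp : p = r / (τ * k) + s * lam / m := by
      field_simp at h₂ ⊢
      linarith
    have ht : t = -(k * m) / (2 * P) := by
      rw [eq_div_iff (by positivity)]
      refine mul_right_cancel₀ (mul_pos hd hτ).ne' ?_
      rw [hs, hr, hu] at h₅
      field_simp at h₅
      linear_combination 2 * t * hP' - h₅
    refine ⟨?_, rfl, ?_, ?_, ht, ?_⟩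
    · rw [hp, hr, hs, ht]; field_simp
    · rw [hr, ht]; field_simp
    · rw [hs, ht]; field_simp
    · rw [hu, ht]; field_simp; ring
  · rintro ⟨rfl, rfl, rfl, rfl, rfl, rfl⟩
    refine ⟨by simp, ?_, ?_, ?_, ?_, ?_⟩
    · field_simp; ring
    · field_simp; ring
    · field_simp; ring
    · field_simp
      linear_combination -hP'
    · field_simp; ring

/-- The Lyapunov equation of a mode, for a symmetric matrix, in terms of matrix entries. -/
theorem lyapunov_iff_entries {m d k τ γ lam : ℝ} (hk : 0 < k) (p q r s t u : ℝ) :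
    (!![p, q, r; q, s, t; r, t, u]
        * !![0, 1, 0; -lam / m, -d / m, 1 / m; 0, -1 / (τ * k), -γ * lam / τ]
      + (!![0, 1, 0; -lam / m, -d / m, 1 / m; 0, -1 / (τ * k), -γ * lam / τ]).transpose
        * !![p, q, r; q, s, t; r, t, u]
      + (!![0, 0, Real.sqrt k]).transpose * !![0, 0, Real.sqrt k] = 0) ↔
    (q * (-lam / m) = 0 ∧
      p + q * (-d / m) + r * (-1 / (τ * k)) + s * (-lam / m) = 0 ∧
      q + s * (-d / m) + t * (-1 / (τ * k)) = 0 ∧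
      q * (1 / m) + r * (-γ * lam / τ) + t * (-lam / m) = 0 ∧
      s * (1 / m) + t * (-γ * lam / τ) + r + t * (-d / m) + u * (-1 / (τ * k)) = 0 ∧
      2 * (t * (1 / m) + u * (-γ * lam / τ)) + k = 0) := by
  have hsq := Real.mul_self_sqrt hk.le
  rw [← Matrix.ext_iff]
  simp only [Fin.forall_fin_succ, Matrix.add_apply, Matrix.mul_apply, Fin.sum_univ_succ,
    Matrix.transpose_apply]
  simp [-mul_eq_zero, -div_eq_zero_iff, hsq]
  constructor
  · rintro ⟨⟨h₁, h₂, h₃⟩, ⟨h₄, h₅, h₆⟩, h₇, h₈, h₉⟩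
    refine ⟨?_, ?_, ?_, ?_, ?_, ?_⟩ <;> linarith
  · rintro ⟨h₁, h₂, h₃, h₄, h₅, h₆⟩
    refine ⟨⟨?_, ?_, ?_⟩, ⟨?_, ?_, ?_⟩, ?_, ?_, ?_⟩ <;> linarith

theorem Matrix.IsSymm.eq_of_fin_three {X : Matrix (Fin 3) (Fin 3) ℝ} (hX : X.IsSymm) :
    X = !![X 0 0, X 0 1, X 0 2; X 0 1, X 1 1, X 1 2; X 0 2, X 1 2, X 2 2] := by
  ext i j
  fin_cases i <;> fin_cases j <;> first | rfl | exact hX.apply _ _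


/-- Per-mode H₂ contribution for the distributed averaging controller:
for the Hurwitz matrix A_λ = [[0,1,0],[−λ/m,−d/m,1/m],[0,−1/(τk),−γλ/τ]], output
C_λ = (0,0,√k) and input B_λ = (0,b/m,0)ᵀ, the Lyapunov equation
X A_λ + A_λᵀ X + C_λᵀC_λ = 0 has a unique symmetric solution X_λ, and it satisfies
B_λᵀ X_λ B_λ = (b²/(2τd))·1/(z₂λ² + z₁λ + 1) with z₂ = mkγ²/τ and
z₁ = mγ/(dτ) + kdγ + kτ. -/
theorem per_mode_H2_contribution
    (m d k τ γ b lam : ℝ)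
    (hm : 0 < m) (hd : 0 < d) (hk : 0 < k) (hτ : 0 < τ) (hγ : 0 < γ) (hb : 0 < b)
    (hlam : 0 < lam)
    (A : Matrix (Fin 3) (Fin 3) ℝ)
    (hA : A = !![0, 1, 0; -lam / m, -d / m, 1 / m; 0, -1 / (τ * k), -γ * lam / τ])
    (C : Matrix (Fin 1) (Fin 3) ℝ) (hC : C = !![0, 0, Real.sqrt k])
    (B : Matrix (Fin 3) (Fin 1) ℝ) (hB : B = !![0; b / m; 0]) :
    (∃! X : Matrix (Fin 3) (Fin 3) ℝ,
        X.IsSymm ∧ X * A + A.transpose * X + C.transpose * C = 0) ∧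
    ∀ X : Matrix (Fin 3) (Fin 3) ℝ,
      X.IsSymm → X * A + A.transpose * X + C.transpose * C = 0 →
      (B.transpose * X * B) 0 0
        = b ^ 2 / (2 * τ * d) *
            (1 / ((m * k * γ ^ 2 / τ) * lam ^ 2 + (m * γ / (d * τ) + k * d * γ + k * τ) * lam + 1)) := by
  subst hA hC hB
  obtain ⟨P, hP⟩ : ∃ P : ℝ, P = (m * k * γ ^ 2 / τ) * lam ^ 2
    + (m * γ / (d * τ) + k * d * γ + k * τ) * lam + 1 := ⟨_, rfl⟩
  have hP0 : 0 < P := by rw [hP]; positivity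
  have key (p q r s t u : ℝ) := (lyapunov_iff_entries (m := m) (d := d) (τ := τ) (γ := γ)
    (lam := lam) hk p q r s t u).trans (gramian_entries_iff hm hd hk hτ hγ hlam hP p q r s t u)
  rw [← hP]
  refine ⟨⟨_, ⟨?_, (key _ _ _ _ _ _).2 ⟨rfl, rfl, rfl, rfl, rfl, rfl⟩⟩, ?_⟩, ?_⟩
  · ext i j
    fin_cases i <;> fin_cases j <;> rfl
  · rintro Y ⟨hY, hYeq⟩
    rw [hY.eq_of_fin_three] at hYeq ⊢
    obtain ⟨h₁, h₂, h₃, h₄, h₅, h₆⟩ := (key _ _ _ _ _ _).1 hYeq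
    rw [h₁, h₂, h₃, h₄, h₅, h₆]
  · intro X hX hXeq
    rw [hX.eq_of_fin_three] at hXeq
    obtain ⟨-, -, -, h, -, -⟩ := (key _ _ _ _ _ _).1 hXeq
    simp only [Matrix.mul_apply, Fin.sum_univ_succ, Matrix.transpose_apply]
    simp [h]
    field_simp
end

section
/- (High averaging gain limit, Theorem 3(ii).) For fixed m, d, k, τ, b > 0 and fixed reals 0 = λ₁ < λ₂ ≤ … ≤ λₙ (the eigenvalues of a connected graph Laplacian), lim_{γ → ∞} (b²/(2τd)) · ∑_{i=1}^{n} 1/( (mkγ²/τ)λᵢ² + (mγ/(dτ) + kdγ + kτ)λᵢ + 1 ) = b²/(2τd). In particular, in the high-gain limit the squared H₂ norm of the distributed-averaging closed loop is independent of the system size n and coincides with the broadcast controller performance b²/(2τd). -/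
open Filter

/-- The contribution of a nonzero Laplacian eigenvalue `x` to the squared H₂ norm vanishes as the
averaging gain grows. -/
theorem tendsto_mode_contribution_atTop_zero {m d k τ x : ℝ} (hm : 0 < m) (hd : 0 < d)
    (hk : 0 < k) (hτ : 0 < τ) (hx : 0 < x) :
    Tendsto (fun γ : ℝ => 1 / ((m * k * γ ^ 2 / τ) * x ^ 2 +
        (m * γ / (d * τ) + k * d * γ + k * τ) * x + 1)) atTop (nhds 0) := by
  simp only [one_div]
  refine Tendsto.inv_tendsto_atTop ?_
  refine tendsto_atTop_mono' atTop ?_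
    (tendsto_id.const_mul_atTop (show 0 < k * d * x by positivity))
  filter_upwards [eventually_ge_atTop 0] with γ hγ
  have h₁ : 0 ≤ m * k * γ ^ 2 / τ * x ^ 2 := by positivity
  have h₂ : 0 ≤ m * γ / (d * τ) * x := by positivity
  have h₃ : 0 ≤ k * τ * x := by positivity
  simp only [id]
  linarith

/-- High averaging gain limit, Theorem 3(ii): for the eigenvalues
0 = λ₁ < λ₂ ≤ … ≤ λₙ of a connected graph Laplacian, as the averaging gain γ → ∞ the squared
H₂ norm expression (b²/(2τd))·∑ᵢ 1/(z₂λᵢ² + z₁λᵢ + 1), with z₂ = mkγ²/τ and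
z₁ = mγ/(dτ) + kdγ + kτ, tends to b²/(2τd) — independent of the system size n and equal to
the broadcast controller performance. -/
theorem high_gain_limit
    {n : ℕ} (hn : 2 ≤ n)
    (m d k τ b : ℝ) (hm : 0 < m) (hd : 0 < d) (hk : 0 < k) (hτ : 0 < τ) (hb : 0 < b)
    (lam : Fin n → ℝ)
    (hmono : Monotone lam)
    (h0 : lam ⟨0, by omega⟩ = 0)
    (hpos : ∀ i : Fin n, i ≠ ⟨0, by omega⟩ → 0 < lam i) :
    Tendsto
      (fun γ : ℝ =>
        b ^ 2 / (2 * τ * d) *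
          ∑ i, 1 / ((m * k * γ ^ 2 / τ) * (lam i) ^ 2 +
              (m * γ / (d * τ) + k * d * γ + k * τ) * lam i + 1))
      atTop (nhds (b ^ 2 / (2 * τ * d))) := by
  have hlim : ∀ i ∈ Finset.univ, Tendsto
      (fun γ : ℝ => 1 / ((m * k * γ ^ 2 / τ) * (lam i) ^ 2 +
        (m * γ / (d * τ) + k * d * γ + k * τ) * lam i + 1))
      atTop (nhds (if i = ⟨0, by omega⟩ then 1 else 0)) := by
    intro i _
    split_ifs with hi
    · simp [hi, h0]
    · exact tendsto_mode_contribution_atTop_zero hm hd hk hτ (hpos i hi)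
  simpa using (tendsto_finsetSum _ hlim).const_mul (b ^ 2 / (2 * τ * d))
end
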